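/- arXiv:2508.03271 — 6 statements merged into one kernel-verified Lean document; each statement's English description precedes it below -/
import Mathlib

section
/- Let A be a unital C*-algebra, B a unital C*-subalgebra of A, and E : A → A a conditional expectation onto B. Let λ > 0 be a real number. Then E(m) ≥ λ·m for every positive element m of A if and only if ‖E(m)‖ ≥ λ·‖m‖ for every positive element m of A. -/
/-- Pimsner–Popa type inequality for a conditional expectation `E : A → A` onto a unital
C*-subalgebra `B` of a unital C*-algebra `A`:  `E(m) ≥ λ·m` for all positive `m` iff
`‖E(m)‖ ≥ λ·‖m‖` for all positive `m`. -/
theorem conditionalExpectation_pimsnerPopa_iff_norm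
    {A : Type*} [NormedRing A] [StarRing A] [CStarRing A]
    [NormedAlgebra ℂ A] [StarModule ℂ A] [CompleteSpace A]
    [PartialOrder A] [StarOrderedRing A]
    (B : StarSubalgebra ℂ A) (E : A →ₗ[ℂ] A)
    (hrange : ∀ x : A, E x ∈ B)
    (hfix : ∀ b ∈ B, E b = b)
    (hpos : ∀ x : A, 0 ≤ x → 0 ≤ E x)
    (hbimod : ∀ b ∈ B, ∀ c ∈ B, ∀ x : A, E (b * x * c) = b * E x * c)
    (lam : ℝ) (hlam : 0 < lam) :
    (∀ m : A, 0 ≤ m → (lam : ℂ) • m ≤ E m) ↔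
      (∀ m : A, 0 ≤ m → lam * ‖m‖ ≤ ‖E m‖) := by
  letI : CStarAlgebra A := {}
  have hsm : ∀ m : A, 0 ≤ m → 0 ≤ (lam : ℂ) • m := fun m hm => by
    rw [Complex.coe_smul]
    exact smul_nonneg hlam.le hm
  have hnsm : ∀ m : A, ‖(lam : ℂ) • m‖ = lam * ‖m‖ := fun m => by
    rw [norm_smul, Complex.norm_real, Real.norm_of_nonneg hlam.le]
  constructor
  · intro h m hm
    rw [← hnsm]
    exact CStarAlgebra.norm_le_norm_of_nonneg_of_le (hsm m hm) (h m hm)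
  · intro h m hm
    have hcont : Continuous E := map_continuous (PositiveLinearMap.mk₀ E hpos)
    have hBeq : (B : Set A) = {x | E x = x} := by
      ext x
      exact ⟨fun hx => hfix x hx, fun hx => by
        have h1 := hrange x
        rwa [show E x = x from hx] at h1⟩
    haveI hBc : IsClosed (B : Set A) := by
      rw [hBeq]
      exact isClosed_eq hcont continuous_id
    have key : ∀ ε : ℝ, 0 < ε → (lam : ℂ) • m ≤ E m + algebraMap ℝ A ε := by
      intro ε hε
      set b : A := E m + algebraMap ℝ A ε with hb
      have hbB : b ∈ B := by
        refine add_mem (hrange m) ?_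
        rw [IsScalarTower.algebraMap_apply ℝ ℂ A]
        exact B.algebraMap_mem _
      have hεpos : IsStrictlyPositive (algebraMap ℝ A ε) := by
        refine IsUnit.isStrictlyPositive ?_ ?_
        · exact (IsUnit.mk0 ε hε.ne').map (algebraMap ℝ A)
        · exact algebraMap_nonneg A hε.le
      have hEb : E m ≤ b := le_add_of_nonneg_right hεpos.nonneg
      have hb0 : 0 ≤ b := (hpos m hm).trans hEb
      have hbs : IsStrictlyPositive b :=
        IsUnit.isStrictlyPositive
          (CStarAlgebra.isUnit_of_le (algebraMap ℝ A ε)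
            (le_add_of_nonneg_left (hpos m hm)) hεpos) hb0
      have hcB : b ^ (-(1 / 2) : ℝ) ∈ B := by
        rw [CFC.rpow_eq_cfc_real hb0]
        exact cfc_mem (𝕜' := ℂ) _ hbB
      have hc0 : 0 ≤ b ^ (-(1 / 2) : ℝ) := CFC.rpow_nonneg
      have hd0 : 0 ≤ b ^ (1 / 2 : ℝ) := CFC.rpow_nonneg
      have hcd := CFC.rpow_neg_mul_rpow (1 / 2 : ℝ) hbs
      have hdc := CFC.rpow_mul_rpow_neg (1 / 2 : ℝ) hbs
      have hcbc := CFC.conjugate_rpow_neg_one_half b hbs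
      have hdd : b ^ (1 / 2 : ℝ) * b ^ (1 / 2 : ℝ) = b := by
        rw [← CFC.rpow_add hbs.isUnit, add_halves, CFC.rpow_one b]
      generalize b ^ (-(1 / 2) : ℝ) = c at *
      generalize b ^ (1 / 2 : ℝ) = d at *
      have hm' : 0 ≤ c * m * c := conjugate_nonneg_of_nonneg hm hc0
      have h1 : ‖E (c * m * c)‖ ≤ 1 := by
        rw [CStarAlgebra.norm_le_one_iff_of_nonneg _ (hpos _ hm'), hbimod c hcB c hcB, ← hcbc]
        exact conjugate_le_conjugate_of_nonneg hEb hc0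
      have h2 : (lam : ℂ) • (c * m * c) ≤ 1 := by
        rw [← CStarAlgebra.norm_le_one_iff_of_nonneg _ (hsm _ hm'), hnsm]
        exact (h _ hm').trans h1
      have h3 := conjugate_le_conjugate_of_nonneg h2 hd0
      have h4 : d * (c * m * c) * d = m := by
        calc d * (c * m * c) * d = (d * c) * m * (c * d) := by simp only [mul_assoc]
          _ = m := by rw [hcd, hdc, one_mul, mul_one]
      rwa [mul_smul_comm, smul_mul_assoc, h4, mul_one, hdd] at h3
    have ht : Filter.Tendsto (fun ε : ℝ => E m + algebraMap ℝ A ε)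
        (nhdsWithin 0 (Set.Ioi 0)) (nhds (E m)) := by
      have : Continuous (fun ε : ℝ => E m + algebraMap ℝ A ε) :=
        continuous_const.add (continuous_algebraMap ℝ A)
      have h5 := this.tendsto 0
      simp only [map_zero, add_zero] at h5
      exact h5.mono_left nhdsWithin_le_nhds
    refine ge_of_tendsto ht ?_
    filter_upwards [self_mem_nhdsWithin] with ε hε using key ε hε
end

section
/- Let A be a unital C*-algebra, B a unital C*-subalgebra of A, and E : A → A a conditional expectation onto B. Let λ > 0 be a real number, and suppose ‖E(m)‖ ≥ λ·‖m‖ for every positive element m of A. Then for every y ∈ A and every real δ > 0 one has y*y ≤ λ⁻¹·(E(y*y) + δ·1). -/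
theorem condExp_aux
    {A : Type*} [CStarAlgebra A] [PartialOrder A] [StarOrderedRing A]
    (B : StarSubalgebra ℂ A) (E : A →ₗ[ℂ] A)
    (hrange : ∀ x : A, E x ∈ B)
    (hfix : ∀ b ∈ B, E b = b)
    (hpos : ∀ x : A, 0 ≤ x → 0 ≤ E x)
    (hbimod : ∀ b ∈ B, ∀ c ∈ B, ∀ x : A, E (b * x * c) = b * E x * c)
    (lam : ℝ) (hlam : 0 < lam)
    (hnorm : ∀ m : A, 0 ≤ m → lam * ‖m‖ ≤ ‖E m‖) :
    ∀ y : A, ∀ δ : ℝ, 0 < δ →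
      star y * y ≤ ((lam : ℂ))⁻¹ • (E (star y * y) + (δ : ℂ) • (1 : A)) := by
  intro y δ hδ
  have hcont : Continuous E := map_continuous (PositiveLinearMap.mk₀ E hpos)
  have hB : (B : Set A) = {x | E x = x} := by
    ext x
    exact ⟨fun h => hfix x h, fun h => by
      have h' : E x = x := h
      rw [SetLike.mem_coe, ← h']; exact hrange x⟩
  have hclosed : IsClosed (B : Set A) := by
    rw [hB]; exact isClosed_eq hcont continuous_id
  set a := star y * y with ha
  have ha0 : 0 ≤ a := star_mul_self_nonneg y
  have hδ1 : (δ : ℂ) • (1 : A) = algebraMap ℝ A δ := by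
    rw [Algebra.algebraMap_eq_smul_one]; exact Complex.coe_smul δ (1 : A)
  set c := E a + (δ : ℂ) • (1 : A) with hc
  have hδp : IsStrictlyPositive ((δ : ℂ) • (1 : A)) := by
    rw [hδ1]; grind
  have hEc : E a ≤ c := le_add_of_nonneg_right hδp.nonneg
  have hcp : IsStrictlyPositive c := by
    rw [hc, add_comm]; exact hδp.add_nonneg (hpos a ha0)
  have hcB : c ∈ B := add_mem (hrange a) (B.smul_mem (one_mem B) _)
  set b := c ^ (-(1 / 2) : ℝ) with hb
  have hb0 : 0 ≤ b := CFC.rpow_nonneg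
  have hbsa : star b = b := (IsSelfAdjoint.of_nonneg hb0).star_eq
  have hbB : b ∈ B := by
    have h1 : b ∈ Set.range (cfc (R := NNReal) · c) := ⟨_, rfl⟩
    rw [range_cfc_nnreal_eq_image_cfc_real c hcp.nonneg] at h1
    obtain ⟨f, -, hf⟩ := h1
    rw [← hf]
    exact cfc_mem (𝕜' := ℂ) f hcB
  have hm0 : 0 ≤ b * a * b := by
    simpa [hbsa] using star_left_conjugate_nonneg ha0 b
  have hEm : ‖E (b * a * b)‖ ≤ 1 := by
    rw [CStarAlgebra.norm_le_one_iff_of_nonneg _ (hpos _ hm0), hbimod b hbB b hbB,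
      ← CFC.conjugate_rpow_neg_one_half c hcp]
    exact conjugate_le_conjugate_of_nonneg hEc hb0
  have hm : ‖b * a * b‖ ≤ lam⁻¹ := by
    rw [← one_div, le_div_iff₀' hlam]
    exact (hnorm _ hm0).trans hEm
  rw [CStarAlgebra.norm_le_iff_le_algebraMap _ (inv_nonneg.2 hlam.le) hm0] at hm
  set s := c ^ ((1 / 2) : ℝ) with hs
  have hs0 : 0 ≤ s := CFC.rpow_nonneg
  have hsb : s * b = 1 := CFC.rpow_mul_rpow_neg _ hcp
  have hbs : b * s = 1 := CFC.rpow_neg_mul_rpow _ hcp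
  have hss : s * s = c := by
    rw [hs, ← CFC.rpow_add hcp.isUnit]; norm_num; exact CFC.rpow_one c hcp.nonneg
  have key := conjugate_le_conjugate_of_nonneg hm hs0
  have e1 : s * (b * a * b) * s = a := by
    calc s * (b * a * b) * s = (s * b) * a * (b * s) := by simp only [mul_assoc]
      _ = a := by rw [hsb, hbs, one_mul, mul_one]
  have e2 : s * algebraMap ℝ A lam⁻¹ * s = (lam : ℂ)⁻¹ • c := by
    rw [Algebra.algebraMap_eq_smul_one, mul_smul_comm, mul_one, smul_mul_assoc, hss,
      ← Complex.ofReal_inv]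
    exact (Complex.coe_smul _ _).symm
  rwa [e1, e2] at key



/-- If a conditional expectation `E : A → A` onto a unital C*-subalgebra `B` of a unital
C*-algebra `A` satisfies `‖E(m)‖ ≥ λ·‖m‖` for all positive `m`, then for every `y ∈ A` and
every `δ > 0` one has `y*y ≤ λ⁻¹·(E(y*y) + δ·1)`. -/
theorem conditionalExpectation_norm_bound_implies_order_bound
    {A : Type*} [NormedRing A] [StarRing A] [CStarRing A]
    [NormedAlgebra ℂ A] [StarModule ℂ A] [CompleteSpace A]
    [PartialOrder A] [StarOrderedRing A]
    (B : StarSubalgebra ℂ A) (E : A →ₗ[ℂ] A)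
    (hrange : ∀ x : A, E x ∈ B)
    (hfix : ∀ b ∈ B, E b = b)
    (hpos : ∀ x : A, 0 ≤ x → 0 ≤ E x)
    (hbimod : ∀ b ∈ B, ∀ c ∈ B, ∀ x : A, E (b * x * c) = b * E x * c)
    (lam : ℝ) (hlam : 0 < lam)
    (hnorm : ∀ m : A, 0 ≤ m → lam * ‖m‖ ≤ ‖E m‖) :
    ∀ y : A, ∀ δ : ℝ, 0 < δ →
      star y * y ≤ ((lam : ℂ))⁻¹ • (E (star y * y) + (δ : ℂ) • (1 : A)) := by
  let _ : CStarAlgebra A := { }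
  exact condExp_aux B E hrange hfix hpos hbimod lam hlam hnorm
end

section
/- Let M be a von Neumann algebra acting on a complex Hilbert space H, N ⊆ M a von Neumann subalgebra, and E : M → M a conditional expectation onto N. Let λ > 0 be a real number, and suppose that ‖E(P)‖ ≥ λ for every nonzero orthogonal projection P ∈ M (i.e., every nonzero P ∈ M with P = P* and P² = P). Then ‖E(m)‖ ≥ λ·‖m‖ for every positive element m of M. -/
private lemma mul_starProjection_eq_zero_aux
    {H : Type*} [NormedAddCommGroup H] [InnerProductSpace ℂ H] [CompleteSpace H]
    (b c : H →L[ℂ] H) (h : c * b = 0) :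
    c * (b.range.topologicalClosure).starProjection = 0 := by
  have hle : b.range.topologicalClosure ≤ c.ker := by
    apply Submodule.topologicalClosure_minimal
    · rintro _ ⟨y, rfl⟩
      have := congrArg (fun f : H →L[ℂ] H => f y) h
      simpa using this
    · exact c.isClosed_ker
  ext x
  exact hle (Submodule.starProjection_apply_mem _ x)

private lemma exists_spectral_projection_aux
    {H : Type*} [NormedAddCommGroup H] [InnerProductSpace ℂ H] [CompleteSpace H]
    (M : VonNeumannAlgebra H) (m : H →L[ℂ] H) (hm : m ∈ M) (h0 : 0 ≤ m)
    (t : ℝ) (ht0 : 0 ≤ t) (ht : t < ‖m‖) :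
    ∃ P : H →L[ℂ] H, P ∈ M ∧ P ≠ 0 ∧ P = star P ∧ P * P = P ∧ t • P ≤ m := by
  have hsa : IsSelfAdjoint m := IsSelfAdjoint.of_nonneg h0
  set b : H →L[ℂ] H := cfc (fun x : ℝ => max (x - t) 0) m with hb
  have hbnn : 0 ≤ b := cfc_nonneg (fun x _ => le_max_right _ _)
  have hbsa : star b = b := IsSelfAdjoint.of_nonneg hbnn
  have hmt : cfc (fun x : ℝ => x - t) m = m - algebraMap ℝ _ t := by
    rw [cfc_sub (fun x : ℝ => x) (fun _ => t) m, cfc_id' ℝ m, cfc_const t m]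
  have hle : m - algebraMap ℝ _ t ≤ b := by
    rw [← hmt, hb]
    exact cfc_mono (fun x _ => le_max_left _ _)
  have hbne : b ≠ 0 := by
    intro hb0
    rw [hb0, sub_nonpos] at hle
    have := (CStarAlgebra.norm_le_iff_le_algebraMap m ht0 h0).2 hle
    linarith
  have hmul : (m - algebraMap ℝ _ t - b) * b = 0 := by
    rw [← hmt, hb, ← cfc_sub (fun x : ℝ => x - t) (fun x : ℝ => max (x - t) 0) m,
      ← cfc_mul (fun x : ℝ => x - t - max (x - t) 0) (fun x : ℝ => max (x - t) 0) m]
    rw [← cfc_zero ℝ m]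
    congr 1
    funext x
    rcases le_total (x - t) 0 with h | h
    · simp [max_eq_right h]
    · simp [max_eq_left h]
  set P : H →L[ℂ] H := (b.range.topologicalClosure).starProjection with hP
  have hPsa : star P = P := isSelfAdjoint_starProjection _
  have hPP : P * P = P := (Submodule.isIdempotentElem_starProjection _)
  have hkey : ∀ c : H →L[ℂ] H, c * b = 0 → c * P = 0 :=
    fun c h => mul_starProjection_eq_zero_aux b c h
  have hPb : P * b = b := by
    ext x
    exact Submodule.starProjection_eq_self_iff.2 (Submodule.le_topologicalClosure _ ⟨x, rfl⟩)
  have hbP : b * P = b := by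
    have := congrArg star hPb
    rwa [star_mul, hbsa, hPsa] at this
  have hcom1 : ∀ x : H →L[ℂ] H, x * b = b * x → (1 - P) * x * P = 0 := by
    intro x hx
    apply hkey
    rw [mul_assoc, hx, ← mul_assoc, sub_mul, hPb, one_mul, sub_self, zero_mul]
  have hcom : ∀ x : H →L[ℂ] H, x * b = b * x → x * P = P * x := by
    intro x hx
    have h1 := hcom1 x hx
    have h2 := hcom1 (star x) (by
      have := congrArg star hx
      rw [star_mul, star_mul, hbsa] at this
      exact this.symm)
    have h3 := congrArg star h2
    simp only [star_mul, star_sub, star_one, star_star, hPsa, star_zero] at h3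
    have e1 : x * P = P * x * P := by
      rw [sub_mul, sub_mul, one_mul, sub_eq_zero] at h1
      exact h1
    have e2 : P * x = P * x * P := by
      rw [mul_sub, mul_sub, mul_one, sub_eq_zero, ← mul_assoc] at h3
      exact h3
    rw [e1, ← e2]
  have hxb : ∀ x : H →L[ℂ] H, x * m = m * x → x * b = b * x := by
    intro x hx
    have : Commute m x := hx.symm
    exact (this.cfc_real (fun x : ℝ => max (x - t) 0)).eq.symm
  have hmP : m * P = P * m := hcom m (hxb m rfl)
  refine ⟨P, ?_, ?_, hPsa.symm, hPP, ?_⟩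
  · rw [← M.commutant_commutant, VonNeumannAlgebra.mem_commutant_iff]
    intro x hx
    rw [VonNeumannAlgebra.mem_commutant_iff] at hx
    exact hcom x (hxb x (hx m hm).symm)
  · intro h
    rw [h, zero_mul] at hPb
    exact hbne hPb.symm
  · have h4 := hkey _ hmul
    rw [sub_mul, hbP, sub_mul, Algebra.algebraMap_eq_smul_one, smul_mul_assoc, one_mul] at h4
    have h5 : m - t • P = b + (1 - P) * m * star (1 - P) := by
      have h6 : (1 - P) * m * star (1 - P) = m - m * P := by
        rw [star_sub, star_one, hPsa, sub_mul, one_mul, ← hmP, mul_sub, mul_one, sub_mul,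
          mul_assoc, hPP]
        abel
      rw [h6, ← sub_eq_zero, ← h4]
      abel
    rw [← sub_nonneg, h5]
    exact add_nonneg hbnn (star_right_conjugate_nonneg h0 _)

/-- If a conditional expectation `E` from a von Neumann algebra `M` onto a von Neumann
subalgebra `N` satisfies `‖E(P)‖ ≥ λ` for every nonzero orthogonal projection `P ∈ M`,
then `‖E(m)‖ ≥ λ·‖m‖` for every positive `m ∈ M`. -/
theorem vonNeumann_conditionalExpectation_norm_bound_of_projection_bound
    {H : Type*} [NormedAddCommGroup H] [InnerProductSpace ℂ H] [CompleteSpace H]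
    (M N : VonNeumannAlgebra H) (hNM : ∀ x : H →L[ℂ] H, x ∈ N → x ∈ M)
    (E : (H →L[ℂ] H) →ₗ[ℂ] (H →L[ℂ] H))
    (hrange : ∀ x ∈ M, E x ∈ N)
    (hfix : ∀ b ∈ N, E b = b)
    (hpos : ∀ x ∈ M, (0 : H →L[ℂ] H) ≤ x → (0 : H →L[ℂ] H) ≤ E x)
    (hbimod : ∀ b ∈ N, ∀ c ∈ N, ∀ x ∈ M, E (b * x * c) = b * E x * c)
    (lam : ℝ) (hlam : 0 < lam)
    (hproj : ∀ P : H →L[ℂ] H, P ∈ M → P ≠ 0 → P = star P → P * P = P → lam ≤ ‖E P‖) :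
    ∀ m ∈ M, (0 : H →L[ℂ] H) ≤ m → lam * ‖m‖ ≤ ‖E m‖ := by
  intro m hm h0
  have hEm := hpos m hm h0
  have key : ∀ t : ℝ, 0 ≤ t → t < ‖m‖ → lam * t ≤ ‖E m‖ := by
    intro t ht0 ht
    obtain ⟨P, hPM, hPne, hPs, hPP, hPle⟩ := exists_spectral_projection_aux M m hm h0 t ht0 ht
    have hP0 : 0 ≤ P := by
      have := star_mul_self_nonneg P
      rwa [← hPs, hPP] at this
    have htP : t • P ∈ M := by
      have : ((t : ℂ) • P) ∈ M.toStarSubalgebra := M.toStarSubalgebra.smul_mem hPM (t : ℂ)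
      rwa [Complex.coe_smul] at this
    have hEt : E (t • P) = t • E P := by
      rw [← Complex.coe_smul, map_smul, Complex.coe_smul]
    have h1 := hpos (m - t • P) (sub_mem hm htP) (sub_nonneg.2 hPle)
    rw [map_sub, sub_nonneg, hEt] at h1
    have h2 := CStarAlgebra.norm_le_norm_of_nonneg_of_le
      (smul_nonneg ht0 (hpos P hPM hP0)) h1
    rw [norm_smul, Real.norm_of_nonneg ht0] at h2
    have h3 := mul_le_mul_of_nonneg_left (hproj P hPM hPne hPs hPP) ht0
    linarith
  rcases (norm_nonneg m).eq_or_lt with h | h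
  · rw [← h, mul_zero]
    exact norm_nonneg _
  · rw [← le_div_iff₀' hlam]
    apply le_of_forall_lt_imp_le_of_dense
    intro t ht
    rcases le_total 0 t with h0t | h0t
    · rw [le_div_iff₀' hlam]
      exact key t h0t ht
    · exact h0t.trans (by positivity)
end

section
/- Let M be a von Neumann algebra acting on a complex Hilbert space H, N ⊆ M a von Neumann subalgebra, and E : M → M a conditional expectation onto N. Let λ > 0 be a real number, and suppose that ‖E(P)‖ ≥ λ for every nonzero orthogonal projection P ∈ M (i.e., every nonzero P ∈ M with P = P* and P² = P). Then the Pimsner–Popa inequality E(m) ≥ λ·m holds for every positive element m of M. -/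
theorem aux_spectral_proj
    {H : Type*} [NormedAddCommGroup H] [InnerProductSpace ℂ H] [CompleteSpace H]
    (M : VonNeumannAlgebra H) (x : H →L[ℂ] H) (hxM : x ∈ M) (hx : 0 ≤ x)
    (c : ℝ) (hc : 0 ≤ c) (hcx : c < ‖x‖) :
    ∃ P : H →L[ℂ] H, P ∈ M ∧ P ≠ 0 ∧ P = star P ∧ P * P = P ∧ c • P ≤ x := by
  set d : H →L[ℂ] H := x - algebraMap ℝ (H →L[ℂ] H) c with hd
  have hdsa : IsSelfAdjoint d := by
    refine (IsSelfAdjoint.of_nonneg hx).sub ?_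
    exact IsSelfAdjoint.algebraMap _ (IsSelfAdjoint.all c)
  have hy0 : d⁺ ≠ 0 := by
    intro h
    rw [CFC.posPart_eq_zero_iff d hdsa, hd, sub_nonpos,
      ← CStarAlgebra.norm_le_iff_le_algebraMap x hc hx] at h
    exact absurd h (not_le.mpr hcx)
  have hzy : d⁻ * d⁺ = 0 := CFC.negPart_mul_posPart d
  have hdd : d⁺ - d⁻ = d := CFC.posPart_sub_negPart d hdsa
  have hy : 0 ≤ d⁺ := CFC.posPart_nonneg d
  have hz : 0 ≤ d⁻ := CFC.negPart_nonneg d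
  have hcomm : ∀ a ∈ M.commutant, a * d⁺ = d⁺ * a := by
    intro a ha
    have h1 : Commute d a := by
      have : x * a = a * x := VonNeumannAlgebra.mem_commutant_iff.mp ha x hxM
      have h2 : Commute x a := this
      exact h2.sub_left (Algebra.commutes c a)
    have h3 : Commute (d⁺) a := by
      rw [CFC.posPart_def]
      exact h1.cfcₙ_real _
    exact h3.symm
  generalize d⁺ = y at *
  generalize d⁻ = z at *
  set K : Submodule ℂ H := y.range.topologicalClosure with hK
  have : CompleteSpace K := (Submodule.isClosed_topologicalClosure _).completeSpace_coe
  set P := K.starProjection with hP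
  have hPs : IsStarProjection P := isStarProjection_starProjection
  have hPy : P * y = y := by
    ext v
    exact Submodule.starProjection_eq_self_iff.mpr
      (Submodule.le_topologicalClosure _ (LinearMap.mem_range_self _ v))
  have hzP : z * P = 0 := by
    ext v
    have h1 : K ≤ z.ker := by
      refine Submodule.topologicalClosure_minimal _ ?_ z.isClosed_ker
      rintro _ ⟨w, rfl⟩
      exact congr($hzy w)
    exact h1 (Submodule.starProjection_apply_mem K v)
  have hPsa : star P = P := hPs.isSelfAdjoint.star_eq
  have hPz : P * z = 0 := by
    have := congr(star $hzP)
    rwa [star_mul, hPsa, (IsSelfAdjoint.of_nonneg hz).star_eq, star_zero] at this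
  have hyP : y * P = y := by
    have := congr(star $hPy)
    rwa [star_mul, hPsa, (IsSelfAdjoint.of_nonneg hy).star_eq] at this
  refine ⟨P, ?_, ?_, hPsa.symm, hPs.isIdempotentElem, ?_⟩
  · rw [VonNeumannAlgebra.IsStarProjection.mem_iff hPs]
    intro a ha
    rw [hP, Submodule.range_starProjection]
    have h1 : K ≤ K.comap (a : H →ₗ[ℂ] H) := by
      refine Submodule.topologicalClosure_minimal _ ?_ ?_
      · rintro _ ⟨w, rfl⟩
        refine Submodule.le_topologicalClosure _ ⟨a w, ?_⟩
        exact congr($(hcomm a ha) w).symm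
      · exact (Submodule.isClosed_topologicalClosure _).preimage a.continuous
    exact h1
  · rintro h
    rw [h, zero_mul] at hPy
    exact hy0 hPy.symm
  · have hPP : P * P = P := hPs.isIdempotentElem
    have hxe : x = algebraMap ℝ (H →L[ℂ] H) c + y - z := by
      rw [add_sub_assoc, hdd, hd]; abel
    have hx1 : (1 - P) * x * (1 - P) = algebraMap ℝ (H →L[ℂ] H) c - c • P - z := by
      rw [hxe, Algebra.algebraMap_eq_smul_one]
      simp only [sub_mul, mul_sub, add_mul, mul_add, one_mul, mul_one, hPy, hyP, hPz, hzP, hPP,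
        smul_mul_assoc, mul_smul_comm]
      simp [smul_sub]
    have h2 : 0 ≤ (1 - P) * x * (1 - P) :=
      (hPs.one_sub.isSelfAdjoint).conjugate_nonneg hx
    have h3 : x - c • P = y + (1 - P) * x * (1 - P) := by
      rw [hx1]; nth_rw 1 [hxe]; abel
    rw [← sub_nonneg, h3]
    exact add_nonneg hy h2

/-- If a conditional expectation `E` from a von Neumann algebra `M` onto a von Neumann
subalgebra `N` satisfies `‖E(P)‖ ≥ λ` for every nonzero orthogonal projection `P ∈ M`,
then the Pimsner–Popa inequality `E(m) ≥ λ·m` holds for every positive `m ∈ M`. -/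
theorem vonNeumann_conditionalExpectation_pimsnerPopa_of_projection_bound
    {H : Type*} [NormedAddCommGroup H] [InnerProductSpace ℂ H] [CompleteSpace H]
    (M N : VonNeumannAlgebra H) (hNM : ∀ x : H →L[ℂ] H, x ∈ N → x ∈ M)
    (E : (H →L[ℂ] H) →ₗ[ℂ] (H →L[ℂ] H))
    (hrange : ∀ x ∈ M, E x ∈ N)
    (hfix : ∀ b ∈ N, E b = b)
    (hpos : ∀ x ∈ M, (0 : H →L[ℂ] H) ≤ x → (0 : H →L[ℂ] H) ≤ E x)
    (hbimod : ∀ b ∈ N, ∀ c ∈ N, ∀ x ∈ M, E (b * x * c) = b * E x * c)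
    (lam : ℝ) (hlam : 0 < lam)
    (hproj : ∀ P : H →L[ℂ] H, P ∈ M → P ≠ 0 → P = star P → P * P = P → lam ≤ ‖E P‖) :
    ∀ m ∈ M, (0 : H →L[ℂ] H) ≤ m → lam • m ≤ E m := by
  intro m hmM hm
  have key : ∀ x ∈ M, 0 ≤ x → ‖E x‖ ≤ 1 → ‖x‖ ≤ lam⁻¹ := by
    intro x hxM hx hEx
    by_contra! hlt
    obtain ⟨c, hc1, hc2⟩ := exists_between hlt
    have hc0 : 0 < c := (inv_pos.mpr hlam).trans hc1
    obtain ⟨P, hPM, hP0, hPs, hPP, hle⟩ := aux_spectral_proj M x hxM hx c hc0.le hc2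
    have hP : IsStarProjection P := ⟨hPP, hPs.symm⟩
    have hEP : 0 ≤ E P := hpos P hPM hP.nonneg
    have hcP : c • P ∈ M := by
      have : ((c : ℂ) • P) ∈ M.toStarSubalgebra := M.toStarSubalgebra.smul_mem hPM _
      exact this
    have h1 : 0 ≤ E (x - c • P) := hpos _ (sub_mem hxM hcP) (sub_nonneg.mpr hle)
    have h2 : E (c • P) = c • E P := E.map_smul_of_tower c P
    rw [map_sub, h2, sub_nonneg] at h1
    have h3 := CStarAlgebra.norm_le_norm_of_nonneg_of_le (smul_nonneg hc0.le hEP) h1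
    rw [norm_smul, Real.norm_of_nonneg hc0.le] at h3
    have h4 := hproj P hPM hP0 hPs hPP
    have h5 : 1 < c * lam := by rwa [inv_lt_iff_one_lt_mul₀ hlam] at hc1
    nlinarith [mul_le_mul_of_nonneg_left h4 hc0.le]
  have hEm : 0 ≤ E m := hpos m hmM hm
  have main : ∀ e : ℝ, 0 < e → lam • m ≤ E m + algebraMap ℝ (H →L[ℂ] H) e := by
    intro e he
    set a := E m + algebraMap ℝ (H →L[ℂ] H) e with ha
    have heN : algebraMap ℝ (H →L[ℂ] H) e ∈ N := by
      have : algebraMap ℂ (H →L[ℂ] H) (e : ℂ) ∈ N.toStarSubalgebra :=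
        N.toStarSubalgebra.algebraMap_mem _
      exact this
    have haN : a ∈ N := add_mem (hrange m hmM) heN
    have hsp : IsStrictlyPositive a := by
      have : IsStrictlyPositive (algebraMap ℝ (H →L[ℂ] H) e) := isStrictlyPositive_algebraMap he
      exact this.nonneg_add hEm
    have hb0 : 0 ≤ a ^ (-(1 / 2) : ℝ) := CFC.rpow_nonneg
    have hbN : a ^ (-(1 / 2) : ℝ) ∈ N := by
      rw [← VonNeumannAlgebra.commutant_commutant N, VonNeumannAlgebra.mem_commutant_iff]
      intro g hg
      have h1 : Commute a g := VonNeumannAlgebra.mem_commutant_iff.mp hg a haN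
      exact (h1.cfc_nnreal (fun t => t ^ (-(1 / 2) : ℝ))).symm
    have hs : CFC.sqrt a * CFC.sqrt a = a := CFC.sqrt_mul_sqrt_self a hsp.nonneg
    have hs0 : 0 ≤ CFC.sqrt a := CFC.sqrt_nonneg a
    have hbab := CFC.conjugate_rpow_neg_one_half a hsp
    have hsb : CFC.sqrt a * a ^ (-(1 / 2) : ℝ) = 1 := by
      rw [CFC.sqrt_eq_rpow]; exact CFC.rpow_mul_rpow_neg _ hsp
    have hbs : a ^ (-(1 / 2) : ℝ) * CFC.sqrt a = 1 := by
      rw [CFC.sqrt_eq_rpow]; exact CFC.rpow_neg_mul_rpow _ hsp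
    generalize a ^ (-(1 / 2) : ℝ) = b at *
    generalize CFC.sqrt a = s at *
    have hx0 : 0 ≤ b * m * b := (IsSelfAdjoint.of_nonneg hb0).conjugate_nonneg hm
    have hxM : b * m * b ∈ M := mul_mem (mul_mem (hNM b hbN) hmM) (hNM b hbN)
    have hEx : E (b * m * b) ≤ 1 := by
      rw [hbimod b hbN b hbN m hmM, ← hbab]
      refine conjugate_le_conjugate_of_nonneg ?_ hb0
      rw [ha]
      exact le_add_of_nonneg_right (algebraMap_nonneg _ he.le)
    have hx1 := key _ hxM hx0 ((CStarAlgebra.norm_le_one_iff_of_nonneg _ (hpos _ hxM hx0)).mpr hEx)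
    rw [CStarAlgebra.norm_le_iff_le_algebraMap _ (inv_pos.mpr hlam).le hx0] at hx1
    have h2 := conjugate_le_conjugate_of_nonneg hx1 hs0
    have h3 : s * (b * m * b) * s = m := by
      calc s * (b * m * b) * s = (s * b) * m * (b * s) := by simp only [mul_assoc]
        _ = m := by rw [hsb, hbs, one_mul, mul_one]
    rw [h3, Algebra.algebraMap_eq_smul_one, mul_smul_comm, smul_mul_assoc, mul_one, hs] at h2
    have h4 := smul_le_smul_of_nonneg_left h2 hlam.le
    rwa [smul_smul, mul_inv_cancel₀ hlam.ne', one_smul] at h4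
  have hlim : Filter.Tendsto (fun e : ℝ => E m + algebraMap ℝ (H →L[ℂ] H) e)
      (nhdsWithin 0 (Set.Ioi 0)) (nhds (E m)) := by
    have : Continuous (fun e : ℝ => E m + algebraMap ℝ (H →L[ℂ] H) e) :=
      continuous_const.add (algebraMapCLM ℝ (H →L[ℂ] H)).continuous
    have h := this.tendsto 0
    simp only [map_zero, add_zero] at h
    exact h.mono_left nhdsWithin_le_nhds
  exact ge_of_tendsto hlim (Filter.eventually_of_mem self_mem_nhdsWithin main)
end

section
/- Let ε₀ be a real number with 0 < ε₀ < 1 and let m ≥ 1 be a positive integer. Let a and b be real numbers with ε₀/2 ≤ a ≤ 1 and 0 < b ≤ ε₀/(2m). Then a·log(a/b) + (1 − a)·log((1 − a)/(1 − b)) ≥ (ε₀·log m)/2 − e⁻¹ + log(1 − ε₀/(2m)), where log denotes the natural logarithm and, in the case a = 1, the term (1 − a)·log((1 − a)/(1 − b)) is interpreted as 0. -/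
/-- Lower bound for the Kullback–Leibler divergence between Bernoulli distributions with
parameters `a` and `b`, where `ε₀/2 ≤ a ≤ 1` and `0 < b ≤ ε₀/(2m)`. -/
theorem bernoulli_klDiv_lower_bound
    (ε₀ : ℝ) (hε₀ : 0 < ε₀) (hε₁ : ε₀ < 1) (m : ℕ) (hm : 1 ≤ m)
    (a b : ℝ) (ha₁ : ε₀ / 2 ≤ a) (ha₂ : a ≤ 1) (hb₁ : 0 < b) (hb₂ : b ≤ ε₀ / (2 * m)) :
    ε₀ * Real.log m / 2 - (Real.exp 1)⁻¹ + Real.log (1 - ε₀ / (2 * m)) ≤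
      a * Real.log (a / b) + (1 - a) * Real.log ((1 - a) / (1 - b)) := by
  have hm' : (1:ℝ) ≤ m := by exact_mod_cast hm
  have hm0 : (0:ℝ) < m := by linarith
  have hx : ε₀ / (2 * m) < 1 := by
    rw [div_lt_one (by positivity)]; linarith
  have hx0 : 0 < ε₀ / (2 * m) := by positivity
  have hlm : 0 ≤ Real.log m := Real.log_nonneg hm'
  have hab : (m:ℝ) ≤ a / b := by
    rw [le_div_iff₀ hb₁]
    have h1 : (m:ℝ) * b ≤ m * (ε₀ / (2 * m)) := mul_le_mul_of_nonneg_left hb₂ hm0.le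
    have h2 : (m:ℝ) * (ε₀ / (2 * m)) = ε₀ / 2 := by field_simp
    linarith
  have h1 : ε₀ * Real.log m / 2 ≤ a * Real.log (a / b) := by
    have h2 : Real.log m ≤ Real.log (a / b) := Real.log_le_log hm0 hab
    have h3 : ε₀ / 2 * Real.log m ≤ a * Real.log (a / b) :=
      mul_le_mul ha₁ h2 hlm (by linarith)
    linarith
  have h4 : Real.log (1 - ε₀ / (2 * m)) ≤ 0 :=
    Real.log_nonpos (by linarith) (by linarith)
  have h5 : -(Real.exp 1)⁻¹ ≤ (1 - a) * Real.log ((1 - a) / (1 - b)) := by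
    have he : 0 < (Real.exp 1)⁻¹ := by positivity
    rcases ha₂.eq_or_lt with h | h
    · subst h; simp; positivity
    · have hc : 0 < 1 - a := by linarith
      have hb : 0 < 1 - b := by linarith
      rw [Real.log_div hc.ne' hb.ne']
      have h6 : Real.log (1 - b) ≤ 0 := Real.log_nonpos hb.le (by linarith)
      have h7 := Real.log_le_sub_one_of_pos (x := (Real.exp 1)⁻¹ / (1 - a)) (by positivity)
      rw [Real.log_div he.ne' hc.ne', Real.log_inv, Real.log_exp] at h7
      have h8 : (1 - a) * (-Real.log (1 - a)) ≤ (1 - a) * ((Real.exp 1)⁻¹ / (1 - a)) :=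
        mul_le_mul_of_nonneg_left (by linarith) hc.le
      rw [mul_div_cancel₀ _ hc.ne'] at h8
      nlinarith
  linarith
end

section
/- Let μ₁ and μ₂ be Borel probability measures on the interval [0,1] ⊆ ℝ, let ε₀ be a real number with 0 < ε₀ < 1, and let m ≥ 1 be a positive integer. Suppose ∫ x dμ₁(x) ≥ ε₀ and ∫ x dμ₂(x) ≤ ε₀²/(4m). Then the Kullback–Leibler divergence satisfies KL(μ₁ ‖ μ₂) ≥ (ε₀·log m)/2 − e⁻¹ + log(1 − ε₀/(2m)), where log denotes the natural logarithm. -/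
open MeasureTheory Classical

/-- The Kullback–Leibler divergence `KL(μ‖ν) = ∫ log(dμ/dν) dμ` if `μ ≪ ν` and the
log-likelihood ratio is `μ`-integrable, and `+∞` otherwise. -/
noncomputable def klDiv {α : Type*} [MeasurableSpace α] (μ ν : Measure α) : EReal :=
  if μ ≪ ν ∧ Integrable (llr μ ν) μ then ((∫ x, llr μ ν x ∂μ : ℝ) : EReal) else ⊤

/-- For Borel probability measures `μ₁, μ₂` on `[0,1]` with `∫ x dμ₁ ≥ ε₀` and
`∫ x dμ₂ ≤ ε₀²/(4m)`, one has
`KL(μ₁‖μ₂) ≥ ε₀·log m / 2 − e⁻¹ + log(1 − ε₀/(2m))`. -/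
theorem klDiv_lower_bound_of_integral_bounds
    (μ₁ μ₂ : Measure (Set.Icc (0 : ℝ) 1))
    [IsProbabilityMeasure μ₁] [IsProbabilityMeasure μ₂]
    (ε₀ : ℝ) (hε₀ : 0 < ε₀) (hε₁ : ε₀ < 1) (m : ℕ) (hm : 1 ≤ m)
    (h₁ : ε₀ ≤ ∫ x, (x : ℝ) ∂μ₁)
    (h₂ : ∫ x, (x : ℝ) ∂μ₂ ≤ ε₀ ^ 2 / (4 * m)) :
    ((ε₀ * Real.log m / 2 - (Real.exp 1)⁻¹ + Real.log (1 - ε₀ / (2 * m)) : ℝ) : EReal) ≤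
      klDiv μ₁ μ₂ := by
  unfold klDiv
  split_ifs with h
  swap
  · exact le_top
  obtain ⟨hac, hint⟩ := h
  rw [EReal.coe_le_coe_iff]
  have hm' : (1 : ℝ) ≤ m := by exact_mod_cast hm
  have hlog : 0 ≤ Real.log m := Real.log_nonneg hm'
  have hxi : ∀ (μ : Measure (Set.Icc (0 : ℝ) 1)) [IsProbabilityMeasure μ],
      Integrable (fun x : Set.Icc (0 : ℝ) 1 => (x : ℝ)) μ := by
    intro μ _
    refine Integrable.of_bound (C := 1) (by fun_prop) (Filter.Eventually.of_forall fun x => ?_)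
    rw [Real.norm_eq_abs, abs_of_nonneg x.2.1]
    exact x.2.2
  have hk := InformationTheory.integral_klFun_rnDeriv hac hint
  have hki := (InformationTheory.integrable_klFun_rnDeriv_iff hac).2 hint
  simp only [probReal_univ] at hk
  have hai : Integrable (fun x : Set.Icc (0 : ℝ) 1 => (x : ℝ) * Real.log m) μ₁ :=
    (hxi μ₁).mul_const _
  have hri : Integrable (fun x => (μ₁.rnDeriv μ₂ x).toReal • ((x : ℝ) * Real.log m)) μ₂ :=
    (integrable_rnDeriv_smul_iff hac).2 hai
  have hre : ∫ x, (μ₁.rnDeriv μ₂ x).toReal • ((x : ℝ) * Real.log m) ∂μ₂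
      = (∫ x, (x : ℝ) ∂μ₁) * Real.log m := by
    rw [integral_rnDeriv_smul hac, integral_mul_const]
  have hb : Integrable (fun x : Set.Icc (0 : ℝ) 1 => (x : ℝ) * ((m : ℝ) - 1)) μ₂ :=
    (hxi μ₂).mul_const _
  have key : ∫ x, ((μ₁.rnDeriv μ₂ x).toReal • ((x : ℝ) * Real.log m)
      - (x : ℝ) * ((m : ℝ) - 1)) ∂μ₂ ≤
      ∫ x, InformationTheory.klFun (μ₁.rnDeriv μ₂ x).toReal ∂μ₂ := by
    refine integral_mono (hri.sub hb) hki fun x => ?_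
    have hr : 0 ≤ (μ₁.rnDeriv μ₂ x).toReal := ENNReal.toReal_nonneg
    simp only [smul_eq_mul, InformationTheory.klFun_apply]
    generalize (μ₁.rnDeriv μ₂ x).toReal = r at hr
    have hB : Real.exp ((x : ℝ) * Real.log m) ≤ 1 + x * ((m : ℝ) - 1) := by
      have := rpow_one_add_le_one_add_mul_self (s := (m : ℝ) - 1) (by linarith) x.2.1 x.2.2
      rw [Real.rpow_def_of_pos (by linarith)] at this
      simpa [mul_comm] using this
    rcases hr.eq_or_lt with h0 | h0
    · subst h0
      have := Real.exp_pos ((x : ℝ) * Real.log m)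
      simp only [zero_mul]
      linarith
    · have h3 := Real.add_one_le_exp ((x : ℝ) * Real.log m - Real.log r)
      rw [Real.exp_sub, Real.exp_log h0, le_div_iff₀ h0] at h3
      nlinarith
  rw [integral_sub hri hb, hre, integral_mul_const, hk] at key
  have h4 : (∫ x, (x : ℝ) ∂μ₂) * ((m : ℝ) - 1) ≤ 1 / 4 := by
    calc _ ≤ ε₀ ^ 2 / (4 * m) * ((m : ℝ) - 1) :=
          mul_le_mul_of_nonneg_right h₂ (by linarith)
      _ ≤ ε₀ ^ 2 / (4 * m) * m := mul_le_mul_of_nonneg_left (by linarith) (by positivity)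
      _ = ε₀ ^ 2 / 4 := by field_simp
      _ ≤ 1 / 4 := by nlinarith
  have h5 : 1 / 4 ≤ (Real.exp 1)⁻¹ := by
    rw [← one_div]
    exact one_div_le_one_div_of_le (Real.exp_pos 1) (by linarith [Real.exp_one_lt_d9])
  have h6 : Real.log (1 - ε₀ / (2 * m)) ≤ 0 := by
    have h7 : ε₀ / (2 * m) ≤ 1 := by
      rw [div_le_one (by positivity)]
      linarith
    have h8 : 0 ≤ ε₀ / (2 * m) := by positivity
    exact Real.log_nonpos (by linarith) (by linarith)
  have h9 := mul_le_mul_of_nonneg_right h₁ hlog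
  have h10 := mul_nonneg hε₀.le hlog
  linarith
end
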